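/- (Theorem: mean-error decay) Assume ‖μ_A‖₂ ≤ C_A and 0 < η < 2/(C_A + α). Set λ = ‖I − η μ_A − η α I‖₂. Then λ < 1, and the mean error u_n = E[σ_n − σ*] decays exponentially: ‖u_n‖₂ ≤ λⁿ ‖u_0‖₂ for every n ≥ 0. -/

import Mathlib

open Matrix MeasureTheory ProbabilityTheory
open scoped ENNReal

/-- The Euclidean (l²) norm of a vector in `ℝ^m`. -/
noncomputable def evNorm {m : ℕ} (x : Fin m → ℝ) : ℝ :=
  ‖(EuclideanSpace.equiv (Fin m) ℝ).symm x‖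

/-- The spectral (l²-operator) norm of a real matrix. -/
noncomputable def specNorm {a b : ℕ} (M : Matrix (Fin a) (Fin b) ℝ) : ℝ :=
  ‖LinearMap.toContinuousLinearMap (Matrix.toEuclideanLin M)‖

open scoped InnerProductSpace in
/-- A positive symmetric operator `T` with `‖T‖ ≤ C` satisfies `‖T x‖² ≤ C ⟪T x, x⟫`. -/
theorem norm_sq_apply_le_mul_inner {E : Type*} [NormedAddCommGroup E] [InnerProductSpace ℝ E]
    {T : E →L[ℝ] E} (hsymm : ∀ x y, ⟪T x, y⟫_ℝ = ⟪x, T y⟫_ℝ) (hpos : ∀ x, 0 ≤ ⟪T x, x⟫_ℝ)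
    {C : ℝ} (hC : ‖T‖ ≤ C) (x : E) : ‖T x‖ ^ 2 ≤ C * ⟪T x, x⟫_ℝ := by
  have hC0 : 0 ≤ C := (norm_nonneg T).trans hC
  have hTT : ⟪T (T x), T x⟫_ℝ ≤ C * ‖T x‖ ^ 2 := by
    calc ⟪T (T x), T x⟫_ℝ ≤ ‖T (T x)‖ * ‖T x‖ := real_inner_le_norm _ _
      _ ≤ (C * ‖T x‖) * ‖T x‖ := by gcongr; exact T.le_of_opNorm_le hC _
      _ = C * ‖T x‖ ^ 2 := by ring
  have h := hpos (C • x - T x)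
  have e : ⟪T (C • x - T x), C • x - T x⟫_ℝ
      = C ^ 2 * ⟪T x, x⟫_ℝ - 2 * C * ‖T x‖ ^ 2 + ⟪T (T x), T x⟫_ℝ := by
    simp only [map_sub, map_smul, inner_sub_left, inner_sub_right, real_inner_smul_left,
      real_inner_smul_right]
    rw [hsymm (T x) x, real_inner_self_eq_norm_sq]
    ring
  rw [e] at h
  rcases hC0.eq_or_lt with h0 | h0
  · have : ‖T x‖ ≤ C * ‖x‖ := T.le_of_opNorm_le hC x
    rw [← h0] at this ⊢
    have h1 : ‖T x‖ = 0 := le_antisymm (by simpa using this) (norm_nonneg _)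
    simp [h1]
  · nlinarith

open scoped InnerProductSpace in
theorem norm_smul_id_sub_smul_le {E : Type*} [NormedAddCommGroup E] [InnerProductSpace ℝ E]
    {T : E →L[ℝ] E} (hsymm : ∀ x y, ⟪T x, y⟫_ℝ = ⟪x, T y⟫_ℝ) (hpos : ∀ x, 0 ≤ ⟪T x, x⟫_ℝ)
    {C : ℝ} (hC : ‖T‖ ≤ C) (a η : ℝ) :
    ‖a • ContinuousLinearMap.id ℝ E - η • T‖ ≤ max |a| |a - η * C| := by
  have hc : 0 ≤ max |a| |a - η * C| := (abs_nonneg a).trans (le_max_left _ _)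
  refine ContinuousLinearMap.opNorm_le_bound _ hc fun x ↦ ?_
  refine le_of_sq_le_sq ?_ (by positivity)
  have hC0 : 0 ≤ C := (norm_nonneg T).trans hC
  have h1 := norm_sq_apply_le_mul_inner hsymm hpos hC x
  have h0 := hpos x
  have h2 : ⟪T x, x⟫_ℝ ≤ C * ‖x‖ ^ 2 := by
    calc ⟪T x, x⟫_ℝ ≤ ‖T x‖ * ‖x‖ := real_inner_le_norm _ _
      _ ≤ (C * ‖x‖) * ‖x‖ := by gcongr; exact T.le_of_opNorm_le hC _
      _ = C * ‖x‖ ^ 2 := by ring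
  have e : ‖(a • ContinuousLinearMap.id ℝ E - η • T) x‖ ^ 2
      = a ^ 2 * ‖x‖ ^ 2 - 2 * a * η * ⟪T x, x⟫_ℝ + η ^ 2 * ‖T x‖ ^ 2 := by
    simp only [_root_.sub_apply, _root_.smul_apply, ContinuousLinearMap.id_apply]
    rw [norm_sub_sq_real, norm_smul, norm_smul, real_inner_smul_left, real_inner_smul_right,
      real_inner_comm, mul_pow, mul_pow, Real.norm_eq_abs, Real.norm_eq_abs, sq_abs, sq_abs]
    ring
  have ha : a ^ 2 ≤ max |a| |a - η * C| ^ 2 := by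
    rw [← sq_abs a]; gcongr; exact le_max_left _ _
  have hb : (a - η * C) ^ 2 ≤ max |a| |a - η * C| ^ 2 := by
    rw [← sq_abs (a - η * C)]; gcongr; exact le_max_right _ _
  rw [e, mul_pow]
  have h3 : η ^ 2 * ‖T x‖ ^ 2 ≤ η ^ 2 * (C * ⟪T x, x⟫_ℝ) := by gcongr
  have hx := sq_nonneg ‖x‖
  have h4 := mul_le_mul_of_nonneg_right ha hx
  have h5 := mul_le_mul_of_nonneg_right hb hx
  rcases le_total (η ^ 2 * C - 2 * a * η) 0 with h | h
  · nlinarith [mul_nonneg (neg_nonneg.2 h) h0]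
  · nlinarith [mul_le_mul_of_nonneg_left h2 h]

theorem evNorm_mulVec_le {m n : ℕ} (M : Matrix (Fin m) (Fin n) ℝ) (v : Fin n → ℝ) :
    evNorm (M *ᵥ v) ≤ specNorm M * evNorm v :=
  (LinearMap.toContinuousLinearMap (Matrix.toEuclideanLin M)).le_opNorm
    ((EuclideanSpace.equiv (Fin n) ℝ).symm v)

theorem specNorm_smul_one_sub_smul_le {n : ℕ} {S : Matrix (Fin n) (Fin n) ℝ}
    (hS : S.PosSemidef) {C : ℝ} (hC : specNorm S ≤ C) (a η : ℝ) :
    specNorm (a • (1 : Matrix (Fin n) (Fin n) ℝ) - η • S) ≤ max |a| |a - η * C| := by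
  have hpos := Matrix.isPositive_toEuclideanLin_iff.2 hS
  refine le_trans (le_of_eq ?_) (norm_smul_id_sub_smul_le
    (T := LinearMap.toContinuousLinearMap (Matrix.toEuclideanLin S)) hpos.1 hpos.2 hC a η)
  unfold specNorm
  congr 1
  ext x i
  simp [Matrix.toLpLin_apply]

theorem integral_comp_of_uniform {N : ℕ} {Ω : Type*} [MeasurableSpace Ω] {P : Measure Ω}
    [IsProbabilityMeasure P] {X : Ω → Fin N} (hX : Measurable X)
    (hunif : ∀ k, P {ω | X ω = k} = 1 / N) (f : Fin N → ℝ) :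
    ∫ ω, f (X ω) ∂P = (N : ℝ)⁻¹ * ∑ k, f k := by
  have := Measure.isProbabilityMeasure_map (μ := P) hX.aemeasurable
  rw [← integral_map (φ := X) hX.aemeasurable (Measurable.of_discrete).aestronglyMeasurable,
    integral_fintype Integrable.of_finite, Finset.mul_sum]
  refine Finset.sum_congr rfl fun k _ ↦ ?_
  have : (P.map X).real {k} = (N : ℝ)⁻¹ := by
    rw [measureReal_def, Measure.map_apply hX (measurableSet_singleton k)]
    change (P {ω | X ω = k}).toReal = _
    simp [hunif k]
  rw [this, smul_eq_mul]

/-- A process driven by an independent noise sequence is independent of the current noise. -/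
theorem indepFun_of_recurrence {ι α Ω : Type*} [Finite ι] [MeasurableSpace ι]
    [MeasurableSingletonClass ι] [MeasurableSpace α] [MeasurableSpace Ω] {P : Measure Ω}
    [IsProbabilityMeasure P] {γ : ℕ → Ω → ι} (hmeas : ∀ n, Measurable (γ n))
    (hindep : iIndepFun γ P) {X : ℕ → Ω → α} {x₀ : α} (step : ι → α → α)
    (h0 : ∀ ω, X 0 ω = x₀) (hrec : ∀ n ω, X (n + 1) ω = step (γ n ω) (X n ω)) (n : ℕ) :
    IndepFun (γ n) (X n) P := by
  have hfac : ∀ m, ∃ g : (Finset.range m → ι) → α, ∀ ω, X m ω = g fun i ↦ γ i ω := by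
    intro m
    induction m with
    | zero => exact ⟨fun _ ↦ x₀, h0⟩
    | succ m ih =>
      obtain ⟨g, hg⟩ := ih
      refine ⟨fun v ↦ step (v ⟨m, by simp⟩)
        (g fun i ↦ v ⟨i, Finset.mem_range.2 ((Finset.mem_range.1 i.2).trans m.lt_succ_self)⟩),
        fun ω ↦ ?_⟩
      rw [hrec, hg]
  obtain ⟨g, hg⟩ := hfac n
  have hfun : X n = g ∘ fun ω (i : Finset.range n) ↦ γ i ω := funext hg
  have key := hindep.indepFun_finset {n} (Finset.range n) (by simp) hmeas
  rw [hfun]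
  have hφ : Measurable fun v : (({n} : Finset ℕ) → ι) ↦ v ⟨n, Finset.mem_singleton_self n⟩ :=
    measurable_pi_apply _
  exact key.comp hφ Measurable.of_discrete

/-- mean-error decay: Assume `‖μ_A‖₂ ≤ C_A` and `0 < η < 2/(C_A + α)`, and
set `λ = ‖I − η μ_A − η α I‖₂`. Then `λ < 1` and the mean error `u_n = E[σ_n − σ*]` decays
exponentially: `‖u_n‖₂ ≤ λⁿ ‖u_0‖₂` for every `n ≥ 0`. -/
theorem sgd_mean_error_decay
    (N nx np : ℕ) (hN : 0 < N)
    (A : Fin N → Matrix (Fin np) (Fin nx) ℝ) (b : Fin N → Fin np → ℝ)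
    (μ : Fin N → Matrix (Fin nx) (Fin nx) ℝ) (hμ : ∀ k, μ k = (A k)ᵀ * A k)
    (ν : Fin N → Fin nx → ℝ) (hν : ∀ k, ν k = -((A k)ᵀ *ᵥ b k))
    (μA : Matrix (Fin nx) (Fin nx) ℝ) (hμA : μA = (N : ℝ)⁻¹ • ∑ k, μ k)
    (νA : Fin nx → ℝ) (hνA : νA = (N : ℝ)⁻¹ • ∑ k, ν k)
    (α η : ℝ) (hα : 0 < α) (hη : 0 < η)
    {Ω : Type*} [MeasurableSpace Ω] (P : Measure Ω) [IsProbabilityMeasure P]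
    (γ : ℕ → Ω → Fin N) (hγmeas : ∀ n, Measurable (γ n))
    (hγindep : iIndepFun γ P)
    (hγunif : ∀ n k, P {ω | γ n ω = k} = 1 / N)
    (σ0 : Fin nx → ℝ) (σs : ℕ → Ω → Fin nx → ℝ)
    (hσ0 : ∀ ω, σs 0 ω = σ0)
    (hrec : ∀ n ω, σs (n + 1) ω
      = σs n ω - η • ((μ (γ n ω) + α • (1 : Matrix (Fin nx) (Fin nx) ℝ)) *ᵥ σs n ω + ν (γ n ω)))
    (σstar : Fin nx → ℝ)
    (hσstar : (μA + α • (1 : Matrix (Fin nx) (Fin nx) ℝ)) *ᵥ σstar + νA = 0)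
    (hint : ∀ n, Integrable (σs n) P)
    (u : ℕ → Fin nx → ℝ) (hu : ∀ n i, u n i = ∫ ω, (σs n ω i - σstar i) ∂P)
    (CA : ℝ) (hCA : specNorm μA ≤ CA) (hη2 : η < 2 / (CA + α))
    (lam : ℝ)
    (hlam : lam = specNorm ((1 : Matrix (Fin nx) (Fin nx) ℝ) - η • μA
      - (η * α) • (1 : Matrix (Fin nx) (Fin nx) ℝ)))
    : lam < 1 ∧ ∀ n : ℕ, evNorm (u n) ≤ lam ^ n * evNorm (u 0) := by
  have hμpsd : μA.PosSemidef := by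
    rw [hμA]
    refine Matrix.PosSemidef.smul (Matrix.posSemidef_sum _ fun k _ ↦ ?_) (by positivity)
    rw [hμ k]
    simpa using Matrix.posSemidef_conjTranspose_mul_self (A k)
  constructor
  · have hCA0 : 0 ≤ CA := (norm_nonneg _).trans hCA
    have hη3 : η * (CA + α) < 2 := (lt_div_iff₀ (by positivity)).1 hη2
    have hηC : 0 ≤ η * CA := by positivity
    have hηα : 0 < η * α := by positivity
    have hM : (1 : Matrix (Fin nx) (Fin nx) ℝ) - η • μA - (η * α) • 1
        = (1 - η * α) • (1 : Matrix (Fin nx) (Fin nx) ℝ) - η • μA := by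
      rw [sub_smul, one_smul]; abel
    rw [hlam, hM]
    refine (specNorm_smul_one_sub_smul_le hμpsd hCA _ η).trans_lt (max_lt ?_ ?_) <;>
      rw [abs_lt] <;> constructor <;> nlinarith
  · have hlam0 : 0 ≤ lam := hlam ▸ norm_nonneg _
    have hinti : ∀ n i, Integrable (fun ω ↦ σs n ω i) P := fun n i ↦ (hint n).eval i
    have hu' : ∀ n i, u n i = ∫ ω, σs n ω i ∂P - σstar i := fun n i ↦ by
      rw [hu, integral_sub (hinti n i) (integrable_const _)]; simp
    have hmul : ∀ n (f : Fin N → ℝ) j, Integrable (fun ω ↦ f (γ n ω) * σs n ω j) P ∧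
        ∫ ω, f (γ n ω) * σs n ω j ∂P = ((N : ℝ)⁻¹ * ∑ k, f k) * ∫ ω, σs n ω j ∂P := by
      intro n f j
      have hind : IndepFun (fun ω ↦ f (γ n ω)) (fun ω ↦ σs n ω j) P :=
        (indepFun_of_recurrence hγmeas hγindep
          (fun k x ↦ x - η • ((μ k + α • (1 : Matrix (Fin nx) (Fin nx) ℝ)) *ᵥ x + ν k))
          hσ0 hrec n).comp (φ := f) (ψ := fun v : Fin nx → ℝ ↦ v j)
            Measurable.of_discrete (by fun_prop)
      have hf : Integrable (fun ω ↦ f (γ n ω)) P :=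
        Integrable.comp_measurable Integrable.of_finite (hγmeas n)
      refine ⟨hind.integrable_mul hf (hinti n j), ?_⟩
      rw [hind.integral_fun_mul_eq_mul_integral hf.aestronglyMeasurable
        (hinti n j).aestronglyMeasurable, integral_comp_of_uniform (hγmeas n) (hγunif n)]
    have hmean : ∀ n i, ∫ ω, σs (n + 1) ω i ∂P = ∫ ω, σs n ω i ∂P
        - η * (∑ j, μA i j * ∫ ω, σs n ω j ∂P + α * ∫ ω, σs n ω i ∂P + νA i) := by
      intro n i
      have hν_int : Integrable (fun ω ↦ ν (γ n ω) i) P :=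
        Integrable.comp_measurable (f := γ n) (g := fun k ↦ ν k i) Integrable.of_finite (hγmeas n)
      have hsum_int : Integrable (fun ω ↦ ∑ j, μ (γ n ω) i j * σs n ω j) P :=
        integrable_finsetSum _ fun j _ ↦ (hmul n (fun k ↦ μ k i j) j).1
      have hα_int := (hinti n i).const_mul α
      have hlin_int : Integrable
          (fun ω ↦ ∑ j, μ (γ n ω) i j * σs n ω j + α * σs n ω i) P := hsum_int.add hα_int
      have hgrad_int : Integrable
          (fun ω ↦ ∑ j, μ (γ n ω) i j * σs n ω j + α * σs n ω i + ν (γ n ω) i) P :=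
        hlin_int.add hν_int
      have hstep : ∀ ω, σs (n + 1) ω i = σs n ω i
          - η * (∑ j, μ (γ n ω) i j * σs n ω j + α * σs n ω i + ν (γ n ω) i) := by
        intro ω
        rw [hrec, Matrix.add_mulVec, Matrix.smul_mulVec, Matrix.one_mulVec]
        simp only [Matrix.mulVec, dotProduct, Pi.sub_apply, Pi.smul_apply, Pi.add_apply,
          smul_eq_mul]
      simp_rw [hstep]
      rw [integral_sub (hinti n i) (hgrad_int.const_mul η),
        integral_const_mul, integral_add hlin_int hν_int,
        integral_add hsum_int hα_int, integral_const_mul,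
        integral_finsetSum _ fun j _ ↦ (hmul n (fun k ↦ μ k i j) j).1,
        integral_comp_of_uniform (hγmeas n) (hγunif n) (fun k ↦ ν k i)]
      simp_rw [fun j ↦ (hmul n (fun k ↦ μ k i j) j).2]
      simp [hμA, hνA, Matrix.sum_apply]
    have hstar : ∀ i, ∑ j, μA i j * σstar j + α * σstar i + νA i = 0 := by
      intro i
      have h := congrFun hσstar i
      rw [Matrix.add_mulVec, Matrix.smul_mulVec, Matrix.one_mulVec] at h
      simpa [Matrix.mulVec, dotProduct] using h
    have hu_succ : ∀ n, u (n + 1) = ((1 : Matrix (Fin nx) (Fin nx) ℝ) - η • μA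
        - (η * α) • (1 : Matrix (Fin nx) (Fin nx) ℝ)) *ᵥ u n := by
      intro n
      ext i
      have hdot : (μA *ᵥ u n) i
          = ∑ j, μA i j * ∫ ω, σs n ω j ∂P - ∑ j, μA i j * σstar j := by
        simp [Matrix.mulVec, dotProduct, hu', mul_sub]
      simp only [Matrix.sub_mulVec, Matrix.smul_mulVec, Matrix.one_mulVec, Pi.sub_apply,
        Pi.smul_apply, smul_eq_mul]
      rw [hdot, hu', hu', hmean]
      linear_combination (-η) * hstar i
    intro n
    induction n with
    | zero => simp
    | succ n ih =>
      calc evNorm (u (n + 1)) ≤ lam * evNorm (u n) := by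
            rw [hu_succ, hlam]; exact evNorm_mulVec_le _ _
        _ ≤ lam * (lam ^ n * evNorm (u 0)) := by gcongr
        _ = lam ^ (n + 1) * evNorm (u 0) := by ring
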